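/- For every m≥3, B(t_m) = (m/22)(9t_m−t_{m-1}−5t_{m-2}) + (1/44)(−81t_m+26t_{m-1}+13t_{m-2}) + m + 1/4. -/

import Mathlib

/-- The three-letter alphabet of the Tribonacci word. -/
inductive TLetter : Type
  | a | b | c
deriving DecidableEq

/-- The Tribonacci substitution σ(a)=ab, σ(b)=ac, σ(c)=a. -/
def tsubst : TLetter → List TLetter
  | .a => [.a, .b]
  | .b => [.a, .c]
  | .c => [.a]

/-- `Tword m = σ^m(a)`, the m-th finite Tribonacci word. -/
def Tword : ℕ → List TLetter
  | 0 => [.a]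
  | n + 1 => (Tword n).flatMap tsubst

/-- The prefix 𝕋[1,n] of the Tribonacci word of length n
(each `Tword n` is a prefix of the next and has length ≥ n). -/
def TPrefix (n : ℕ) : List TLetter := (Tword n).take n

/-- A word is a factor of the Tribonacci word 𝕋. -/
def IsFactorT (w : List TLetter) : Prop := ∃ m, w <:+: Tword m

/-- `tribAux i = t_{i-2}`: Tribonacci numbers, shifted so that the index is a natural. -/
def tribAux : ℕ → ℕ
  | 0 => 0
  | 1 => 1
  | 2 => 1
  | n + 3 => tribAux (n + 2) + tribAux (n + 1) + tribAux n

/-- The Tribonacci numbers `t m` for `m : ℤ`: t₋₂=0, t₋₁=1, t₀=1,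
`t m = t (m-1) + t (m-2) + t (m-3)` for m ≥ 1. (Junk value 0 below -2.) -/
def t (m : ℤ) : ℕ := tribAux (m + 2).toNat

/-- Kernel numbers: k₀=0, k₁=k₂=1, `k m = k (m-1) + k (m-2) + k (m-3) - 1` for m ≥ 3. -/
def kAux : ℕ → ℕ
  | 0 => 0
  | 1 => 1
  | 2 => 1
  | n + 3 => kAux (n + 2) + kAux (n + 1) + kAux n - 1

def kker (m : ℤ) : ℕ := kAux m.toNat

/-- `A n`: the number of distinct nonempty words w with ww a factor of 𝕋[1,n]. -/
noncomputable def A (n : ℕ) : ℕ := Nat.card {w : List TLetter // w ≠ [] ∧ (w ++ w) <:+: TPrefix n}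

/-- `B n`: the number of occurrences of squares in 𝕋[1,n], i.e. of pairs (w,i) with
w nonempty, i ≥ 1, ww occurring in 𝕋 at position i and i + 2|w| - 1 ≤ n. -/
noncomputable def B (n : ℕ) : ℕ :=
  Nat.card {p : List TLetter × ℕ // p.1 ≠ [] ∧ 1 ≤ p.2 ∧
    p.2 + 2 * p.1.length - 1 ≤ n ∧ (p.1 ++ p.1) <+: (TPrefix n).drop (p.2 - 1)}

/-- `C n`: the number of distinct nonempty words w with www a factor of 𝕋[1,n]. -/
noncomputable def C (n : ℕ) : ℕ := Nat.card {w : List TLetter // w ≠ [] ∧ (w ++ w ++ w) <:+: TPrefix n}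

/-- `D n`: the number of occurrences of cubes in 𝕋[1,n], i.e. of pairs (w,i) with
w nonempty, i ≥ 1, www occurring in 𝕋 at position i and i + 3|w| - 1 ≤ n. -/
noncomputable def D (n : ℕ) : ℕ :=
  Nat.card {p : List TLetter × ℕ // p.1 ≠ [] ∧ 1 ≤ p.2 ∧
    p.2 + 3 * p.1.length - 1 ≤ n ∧ (p.1 ++ p.1 ++ p.1) <+: (TPrefix n).drop (p.2 - 1)}

namespace Tribonacci

/-! ### The infinite word and its substitution structure -/

theorem Tword_add_three (n : ℕ) : Tword (n + 3) = Tword (n + 2) ++ Tword (n + 1) ++ Tword n := by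
  induction n with
  | zero => decide
  | succ n ih =>
    have h := congrArg (fun l => l.flatMap tsubst) ih
    simp only [List.flatMap_append] at h
    exact h

theorem length_Tword : ∀ n, (Tword n).length = tribAux (n + 2)
  | 0 => rfl
  | 1 => rfl
  | 2 => rfl
  | n + 3 => by
    rw [Tword_add_three, List.length_append, List.length_append, length_Tword (n + 2),
      length_Tword (n + 1), length_Tword n]
    rfl

theorem Tword_prefix_succ : ∀ n, Tword n <+: Tword (n + 1)
  | 0 => by decide
  | 1 => by decide
  | n + 2 => by
    rw [Tword_add_three, List.append_assoc]
    exact List.prefix_append _ _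

theorem Tword_prefix_of_le {m n : ℕ} (h : m ≤ n) : Tword m <+: Tword n := by
  induction n, h using Nat.le_induction with
  | base => exact List.prefix_rfl
  | succ n _ ih => exact ih.trans (Tword_prefix_succ n)

theorem tribAux_add_three (n : ℕ) :
    tribAux (n + 3) = tribAux (n + 2) + tribAux (n + 1) + tribAux n := rfl

theorem lt_tribAux : ∀ n, n < tribAux (n + 2)
  | 0 => by decide
  | 1 => by decide
  | n + 2 => by
    have h := lt_tribAux (n + 1)
    have h0 := lt_tribAux n
    have h1 : tribAux (n + 2 + 2) = tribAux (n + 3) + tribAux (n + 2) + tribAux (n + 1) := rfl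
    have h2 : n + 1 < tribAux (n + 3) := h
    omega

theorem tribAux_succ_pos : ∀ n, 0 < tribAux (n + 1)
  | 0 => by decide
  | n + 1 => (Nat.zero_le n).trans_lt (lt_tribAux n)

/-- The letters of the Tribonacci word, indexed from `0`. -/
def letter (i : ℕ) : TLetter := (Tword i).getD i .a

theorem Tword_getElem? {n i : ℕ} (h : i < (Tword n).length) : (Tword n)[i]? = some (letter i) := by
  have hi : i < (Tword i).length := by rw [length_Tword]; exact lt_tribAux i
  have key : (Tword n)[i]? = (Tword i)[i]? := by
    rcases le_total n i with hni | hni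
    · obtain ⟨s, hs⟩ := Tword_prefix_of_le hni
      rw [← hs, List.getElem?_append_left h]
    · obtain ⟨s, hs⟩ := Tword_prefix_of_le hni
      rw [← hs, List.getElem?_append_left hi]
  rw [key, letter, List.getD_eq_getElem?_getD, List.getElem?_eq_getElem hi]
  rfl

/-- The factor of the Tribonacci word of length `n` starting at the position `i`. -/
def factor (i n : ℕ) : List TLetter := (List.range n).map fun j => letter (i + j)

@[simp] theorem length_factor (i n : ℕ) : (factor i n).length = n := by simp [factor]

theorem factor_add (i m n : ℕ) : factor i (m + n) = factor i m ++ factor (i + m) n := by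
  simp [factor, List.range_add, Function.comp_def, add_assoc]

theorem factor_zero_eq_take {n m : ℕ} (h : n ≤ (Tword m).length) :
    factor 0 n = (Tword m).take n := by
  apply List.ext_getElem?
  intro i
  by_cases hi : i < n
  · rw [List.getElem?_take_of_lt hi, Tword_getElem? (hi.trans_le h)]
    simp [factor, hi]
  · rw [List.getElem?_eq_none (by simpa using hi), List.getElem?_eq_none (by simp; omega)]

theorem le_length_Tword (n : ℕ) : n ≤ (Tword n).length := by
  rw [length_Tword]; exact (lt_tribAux n).le

theorem TPrefix_eq_factor (n : ℕ) : TPrefix n = factor 0 n :=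
  (factor_zero_eq_take (le_length_Tword n)).symm

/-- The length of the image under the substitution of the prefix of length `n`. -/
def imgLen (n : ℕ) : ℕ := ((factor 0 n).flatMap tsubst).length

theorem flatMap_factor_zero (n : ℕ) : (factor 0 n).flatMap tsubst = factor 0 (imgLen n) := by
  have h1 : (factor 0 n).flatMap tsubst <+: Tword (n + 1) := by
    rw [factor_zero_eq_take (le_length_Tword n), Tword]
    conv_rhs => rw [← List.take_append_drop n (Tword n), List.flatMap_append]
    exact List.prefix_append _ _
  rw [show factor 0 (imgLen n) = _ from factor_zero_eq_take (m := n + 1) h1.length_le]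
  exact List.prefix_iff_eq_take.1 h1

theorem imgLen_zero : imgLen 0 = 0 := rfl

theorem factor_one (i : ℕ) : factor i 1 = [letter i] := by simp [factor]

theorem imgLen_succ (n : ℕ) : imgLen (n + 1) = imgLen n + (tsubst (letter n)).length := by
  simp [imgLen, factor_add, factor_one]

theorem factor_imgLen (n : ℕ) :
    factor (imgLen n) (tsubst (letter n)).length = tsubst (letter n) := by
  have h := flatMap_factor_zero (n + 1)
  rw [imgLen_succ, factor_add, factor_add, List.flatMap_append, flatMap_factor_zero, factor_one]
    at h
  simpa using (List.append_cancel_left h).symm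

theorem imgLen_tribAux (k : ℕ) : imgLen (tribAux (k + 2)) = tribAux (k + 3) := by
  rw [imgLen, ← length_Tword, factor_zero_eq_take le_rfl, List.take_length, ← Tword.eq_2,
    length_Tword]

theorem imgLen_succ_a {n : ℕ} (h : letter n = .a) : imgLen (n + 1) = imgLen n + 2 := by
  rw [imgLen_succ, h]; rfl

theorem imgLen_succ_b {n : ℕ} (h : letter n = .b) : imgLen (n + 1) = imgLen n + 2 := by
  rw [imgLen_succ, h]; rfl

theorem imgLen_succ_c {n : ℕ} (h : letter n = .c) : imgLen (n + 1) = imgLen n + 1 := by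
  rw [imgLen_succ, h]; rfl

theorem letter_imgLen (n : ℕ) : letter (imgLen n) = .a := by
  have h := factor_imgLen n
  cases hn : letter n <;> rw [hn] at h <;> simp_all [tsubst, factor, List.range_succ]

theorem letter_imgLen_a {n : ℕ} (hn : letter n = .a) : letter (imgLen n + 1) = .b := by
  have h := factor_imgLen n
  rw [hn] at h; simp_all [tsubst, factor, List.range_succ]

theorem letter_imgLen_b {n : ℕ} (hn : letter n = .b) : letter (imgLen n + 1) = .c := by
  have h := factor_imgLen n
  rw [hn] at h; simp_all [tsubst, factor, List.range_succ]

theorem letter_imgLen_c {n : ℕ} (hn : letter n = .c) : letter (imgLen n + 1) = .a := by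
  rw [← imgLen_succ_c hn]; exact letter_imgLen _

theorem letter_imgLen_succ_ne {m n : ℕ} (h : letter m ≠ letter n) :
    letter (imgLen m + 1) ≠ letter (imgLen n + 1) := by
  cases hm : letter m <;> cases hn : letter n <;>
    simp_all [letter_imgLen_a, letter_imgLen_b, letter_imgLen_c]

theorem imgLen_strictMono : StrictMono imgLen := by
  refine strictMono_nat_of_lt_succ fun n => ?_
  cases h : letter n
  · rw [imgLen_succ_a h]; omega
  · rw [imgLen_succ_b h]; omega
  · rw [imgLen_succ_c h]; omega

theorem lt_imgLen_succ (n : ℕ) : n + 1 < imgLen (n + 1) := by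
  induction n with
  | zero => decide
  | succ n ih => exact (Nat.succ_le_of_lt ih).trans_lt (imgLen_strictMono (Nat.lt_succ_self (n + 1)))

theorem exists_imgLen (i : ℕ) :
    ∃ j, i = imgLen j ∨ (i = imgLen j + 1 ∧ imgLen (j + 1) = i + 1 ∧ letter i ≠ .a) := by
  induction i with
  | zero => exact ⟨0, .inl rfl⟩
  | succ i ih =>
    obtain ⟨j, rfl | ⟨rfl, h, -⟩⟩ := ih
    · cases hj : letter j
      · exact ⟨j, .inr ⟨rfl, imgLen_succ_a hj, by rw [letter_imgLen_a hj]; decide⟩⟩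
      · exact ⟨j, .inr ⟨rfl, imgLen_succ_b hj, by rw [letter_imgLen_b hj]; decide⟩⟩
      · exact ⟨j + 1, .inl (imgLen_succ_c hj).symm⟩
    · exact ⟨j + 1, .inl h.symm⟩

theorem exists_imgLen_of_letter_eq {i : ℕ} (h : letter i = .a) : ∃ j, i = imgLen j := by
  obtain ⟨j, hj | ⟨-, -, hj⟩⟩ := exists_imgLen i
  · exact ⟨j, hj⟩
  · exact absurd h hj

theorem letter_succ_of_ne {i : ℕ} (h : letter i ≠ .a) : letter (i + 1) = .a := by
  obtain ⟨j, rfl | ⟨-, hj, -⟩⟩ := exists_imgLen i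
  · exact absurd (letter_imgLen j) h
  · rw [← hj]; exact letter_imgLen _

theorem letter_of_succ_ne {i : ℕ} (h : letter (i + 1) ≠ .a) : letter i = .a := by
  by_contra hi
  exact h (letter_succ_of_ne hi)

/-- The last letter of the image of a letter determines the letter. -/
theorem letter_imgLen_pred_ne {m n : ℕ} (h : letter m ≠ letter n) :
    letter (imgLen (m + 1) - 1) ≠ letter (imgLen (n + 1) - 1) := by
  cases hm : letter m <;> cases hn : letter n <;>
    simp_all [letter_imgLen_a, letter_imgLen_b, letter_imgLen, imgLen_succ_a, imgLen_succ_b,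
      imgLen_succ_c]

theorem letter_imgLen_pred_eq {m n : ℕ} (h : letter m = letter n) :
    letter (imgLen (m + 1) - 1) = letter (imgLen (n + 1) - 1) := by
  cases hm : letter m <;> cases hn : letter n <;>
    simp_all [letter_imgLen_a, letter_imgLen_b, letter_imgLen, imgLen_succ_a, imgLen_succ_b,
      imgLen_succ_c]

/-! ### Iterated images -/

/-- The length of the `d`-th iterated image of a letter. -/
def iterLen (d : ℕ) : TLetter → ℕ
  | .a => tribAux (d + 2)
  | .b => tribAux (d + 1) + tribAux d
  | .c => tribAux (d + 1)

theorem iterate_imgLen_succ (d x : ℕ) :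
    imgLen^[d] (x + 1) = imgLen^[d] x + iterLen d (letter x) := by
  induction d generalizing x with
  | zero => cases letter x <;> rfl
  | succ d ih =>
    simp only [Function.iterate_succ_apply]
    cases h : letter x
    · rw [imgLen_succ_a h, ih, ih, letter_imgLen, letter_imgLen_a h]
      simp only [iterLen, tribAux]; ring
    · rw [imgLen_succ_b h, ih, ih, letter_imgLen, letter_imgLen_b h]
      simp only [iterLen]; ring
    · rw [imgLen_succ_c h, ih, letter_imgLen]
      simp only [iterLen]

theorem iterate_imgLen_strictMono (d : ℕ) : StrictMono imgLen^[d] :=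
  imgLen_strictMono.iterate d

theorem iterate_imgLen_tribAux (d k : ℕ) :
    imgLen^[d] (tribAux (k + 2)) = tribAux (k + d + 2) := by
  induction d generalizing k with
  | zero => rfl
  | succ d ih =>
    rw [Function.iterate_succ_apply, imgLen_tribAux, ih (k + 1)]
    congr 1; ring

/-- The positions `x` and `y` carry the same factor of length `n`. -/
def Agree (x y n : ℕ) : Prop := ∀ j < n, letter (x + j) = letter (y + j)

theorem Agree.append {x y m n : ℕ} (h : Agree x y m) (h' : Agree (x + m) (y + m) n) :
    Agree x y (m + n) := by
  intro j hj
  rcases lt_or_ge j m with hjm | hjm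
  · exact h j hjm
  · have := h' (j - m) (by omega)
    rwa [add_assoc, add_assoc, Nat.add_sub_cancel' hjm] at this

theorem agree_iterate_imgLen (d : ℕ) {x y : ℕ} (h : letter x = letter y) :
    Agree (imgLen^[d] x) (imgLen^[d] y) (iterLen d (letter x)) := by
  induction d generalizing x y with
  | zero =>
    intro j hj
    have : j = 0 := by cases hx : letter x <;> rw [hx] at hj <;> exact Nat.lt_one_iff.1 hj
    subst this
    exact h
  | succ d ih =>
    simp only [Function.iterate_succ_apply]
    have h1 := ih (x := imgLen x) (y := imgLen y) (by simp only [letter_imgLen])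
    have e1 := iterate_imgLen_succ d (imgLen x)
    have e2 := iterate_imgLen_succ d (imgLen y)
    rw [letter_imgLen] at h1 e1 e2
    cases hx : letter x
    · have h2 := ih (x := imgLen x + 1) (y := imgLen y + 1)
        (by rw [letter_imgLen_a hx, letter_imgLen_a (h.symm.trans hx)])
      rw [letter_imgLen_a hx, e1, e2] at h2
      have := h1.append h2
      have e : iterLen (d + 1) .a = iterLen d .a + iterLen d .b := by
        simp only [iterLen, tribAux]; ring
      rwa [e]
    · have h2 := ih (x := imgLen x + 1) (y := imgLen y + 1)
        (by rw [letter_imgLen_b hx, letter_imgLen_b (h.symm.trans hx)])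
      rw [letter_imgLen_b hx, e1, e2] at h2
      have := h1.append h2
      have e : iterLen (d + 1) .b = iterLen d .a + iterLen d .c := by
        simp only [iterLen]
      rwa [e]
    · exact h1

/-- The length of the common extension to the right, after `d` substitutions, of two positions
carrying distinct letters. -/
def extLen : ℕ → ℕ
  | 0 => 0
  | d + 1 => tribAux (d + 2) + extLen d

theorem two_mul_extLen (d : ℕ) : 2 * extLen d + 3 = tribAux (d + 3) + tribAux (d + 1) := by
  induction d with
  | zero => rfl
  | succ d ih =>
    have h1 : tribAux (d + 1 + 3) = tribAux (d + 3) + tribAux (d + 2) + tribAux (d + 1) := rfl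
    have h2 : extLen (d + 1) = tribAux (d + 2) + extLen d := rfl
    have h3 : tribAux (d + 1 + 1) = tribAux (d + 2) := rfl
    omega

theorem extLen_spec (d : ℕ) {x y : ℕ} (h : letter x ≠ letter y) :
    Agree (imgLen^[d] x) (imgLen^[d] y) (extLen d) ∧
      letter (imgLen^[d] x + extLen d) ≠ letter (imgLen^[d] y + extLen d) := by
  induction d generalizing x y with
  | zero => exact ⟨fun j hj => absurd hj (Nat.not_lt_zero j), h⟩
  | succ d ih =>
    simp only [Function.iterate_succ_apply]
    have h1 := agree_iterate_imgLen d (x := imgLen x) (y := imgLen y) (by simp only [letter_imgLen])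
    have e1 := iterate_imgLen_succ d (imgLen x)
    have e2 := iterate_imgLen_succ d (imgLen y)
    rw [letter_imgLen] at h1 e1 e2
    obtain ⟨h2, h3⟩ := ih (letter_imgLen_succ_ne h)
    rw [e1, e2] at h2 h3
    refine ⟨h1.append h2, ?_⟩
    rw [add_assoc, add_assoc] at h3
    exact h3

theorem agree_iterate_iff (d : ℕ) {x y n : ℕ} (h : letter x ≠ letter y) :
    Agree (imgLen^[d] x) (imgLen^[d] y) n ↔ n ≤ extLen d := by
  obtain ⟨h1, h2⟩ := extLen_spec d h
  refine ⟨fun hn => ?_, fun hn j hj => h1 j (hj.trans_le hn)⟩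
  by_contra hlt
  exact h2 (hn _ (not_le.1 hlt))

/-! ### Squares and isolated letters -/

/-- An agreement between the positions `x` and `y` cannot be extended to the left. -/
def LeftMax (x y : ℕ) : Prop := x = 0 ∨ letter (x - 1) ≠ letter (y - 1)

theorem leftMax_imgLen_iff {x y : ℕ} (hxy : x < y) :
    LeftMax (imgLen x) (imgLen y) ↔ LeftMax x y := by
  obtain ⟨y, rfl⟩ : ∃ z, y = z + 1 := ⟨y - 1, by omega⟩
  cases x with
  | zero => exact ⟨fun _ => .inl rfl, fun _ => .inl rfl⟩
  | succ x =>
    have hx : imgLen (x + 1) ≠ 0 := by have := lt_imgLen_succ x; omega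
    simp only [LeftMax, hx, false_or, Nat.add_sub_cancel, Nat.succ_ne_zero]
    exact ⟨fun h h' => h (letter_imgLen_pred_eq h'), letter_imgLen_pred_ne⟩

theorem leftMax_iterate_iff (d : ℕ) {x y : ℕ} (hxy : x < y) :
    LeftMax (imgLen^[d] x) (imgLen^[d] y) ↔ LeftMax x y := by
  induction d generalizing x y with
  | zero => rfl
  | succ d ih =>
    rw [Function.iterate_succ_apply, Function.iterate_succ_apply, ih (imgLen_strictMono hxy),
      leftMax_imgLen_iff hxy]

theorem LeftMax.letter_eq {x y : ℕ} (h : LeftMax x y) (hxy : x < y) (he : letter x = letter y) :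
    letter x = .a := by
  by_contra hx
  rcases h with rfl | h
  · exact hx rfl
  · obtain ⟨y, rfl⟩ : ∃ z, y = z + 1 := ⟨y - 1, by omega⟩
    cases x with
    | zero => exact hx rfl
    | succ x =>
      exact h ((letter_of_succ_ne hx).trans (letter_of_succ_ne fun hy => hx (he.trans hy)).symm)

/-- Every left-maximal pair of positions is an iterated image of a left-maximal pair of positions
that carry distinct letters. -/
theorem LeftMax.exists_iterate {x y : ℕ} (h : LeftMax x y) (hxy : x < y) :
    ∃ d x₀ y₀, x₀ < y₀ ∧ letter x₀ ≠ letter y₀ ∧ LeftMax x₀ y₀ ∧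
      imgLen^[d] x₀ = x ∧ imgLen^[d] y₀ = y := by
  induction y using Nat.strong_induction_on generalizing x with
  | _ y ih =>
    by_cases he : letter x = letter y
    · have hx := h.letter_eq hxy he
      obtain ⟨j, rfl⟩ := exists_imgLen_of_letter_eq hx
      obtain ⟨k, rfl⟩ := exists_imgLen_of_letter_eq (he.symm.trans hx)
      have hjk := imgLen_strictMono.lt_iff_lt.1 hxy
      have hk : k < imgLen k := by
        obtain ⟨k, rfl⟩ : ∃ z, k = z + 1 := ⟨k - 1, by omega⟩
        exact lt_imgLen_succ k
      obtain ⟨d, x₀, y₀, h1, h2, h3, h4, h5⟩ := ih k hk ((leftMax_imgLen_iff hjk).1 h) hjk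
      refine ⟨d + 1, x₀, y₀, h1, h2, h3, ?_, ?_⟩
      · rw [Function.iterate_succ_apply', h4]
      · rw [Function.iterate_succ_apply', h5]
    · exact ⟨0, x, y, hxy, he, h, rfl, rfl⟩

theorem Agree.exists_leftMax {i p n : ℕ} (h : Agree i (i + p) n) :
    ∃ x o, i = x + o ∧ LeftMax x (x + p) ∧ Agree x (x + p) (o + n) := by
  induction i generalizing n with
  | zero => exact ⟨0, 0, rfl, .inl rfl, by simpa using h⟩
  | succ i ih =>
    by_cases hi : letter i = letter (i + p)
    · have h1 : Agree i (i + p) (1 + n) := by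
        refine Agree.append (fun j hj => ?_) ?_
        · rw [Nat.lt_one_iff.1 hj]; exact hi
        · rwa [add_right_comm]
      obtain ⟨x, o, rfl, h2, h3⟩ := ih h1
      exact ⟨x, o + 1, rfl, h2, by rwa [add_assoc]⟩
    · refine ⟨i + 1, 0, rfl, .inr ?_, by simpa using h⟩
      rwa [add_right_comm]

theorem LeftMax.le_of_agree {x x' o o' p n : ℕ} (h : x + o = x' + o') (hx' : LeftMax x' (x' + p))
    (hx : Agree x (x + p) (o + n)) : x' ≤ x := by
  by_contra hlt
  rcases hx' with rfl | hx'
  · omega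
  · have := hx (x' - 1 - x) (by omega)
    rw [show x + (x' - 1 - x) = x' - 1 by omega, show x + p + (x' - 1 - x) = x' + p - 1 by omega]
      at this
    exact hx' this

/-- The letter at the position `x` differs from its neighbours. -/
def Isolated (x : ℕ) : Prop := letter x ≠ letter (x + 1) ∧ LeftMax x (x + 1)

theorem extLen_lt (d : ℕ) : extLen d < tribAux (d + 2) + tribAux (d + 1) := by
  have h1 := two_mul_extLen d
  have h2 := tribAux_add_three d
  have h3 : tribAux d ≤ tribAux (d + 2) := by
    cases d with
    | zero => decide
    | succ d => rw [tribAux_add_three]; omega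
  omega

theorem tribAux_succ_le_iterLen (d : ℕ) (l : TLetter) : tribAux (d + 1) ≤ iterLen d l := by
  cases l
  · cases d with
    | zero => decide
    | succ d =>
      have : tribAux (d + 1 + 2) = tribAux (d + 1 + 1) + tribAux (d + 1) + tribAux d := rfl
      simp only [iterLen]
      omega
  · simp only [iterLen]; omega
  · exact le_rfl

theorem iterLen_pos (d : ℕ) (l : TLetter) : 0 < iterLen d l :=
  (tribAux_succ_pos d).trans_le (tribAux_succ_le_iterLen d l)

theorem extLen_lt_iterLen_add (d x : ℕ) :
    extLen d < iterLen d (letter x) + iterLen d (letter (x + 1)) := by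
  refine (extLen_lt d).trans_le ?_
  by_cases hx : letter x = .a
  · rw [hx]; exact Nat.add_le_add_left (tribAux_succ_le_iterLen _ _) _
  · rw [letter_succ_of_ne hx, add_comm]
    exact Nat.add_le_add_right (tribAux_succ_le_iterLen _ _) _

/-- Every occurrence of a square is obtained by iterating the substitution at an isolated letter. -/
theorem exists_isolated_of_agree {i p : ℕ} (hp : 0 < p) (h : Agree i (i + p) p) :
    ∃ d x o, Isolated x ∧ i = imgLen^[d] x + o ∧ p = iterLen d (letter x) ∧
      o + p ≤ extLen d := by
  obtain ⟨x, o, rfl, h1, h2⟩ := h.exists_leftMax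
  obtain ⟨d, x₀, y₀, h3, h4, h5, h6, h7⟩ := h1.exists_iterate (by omega)
  rw [← h7, ← h6, agree_iterate_iff d h4] at h2
  have hy : y₀ = x₀ + 1 := by
    by_contra hne
    have h8 := (iterate_imgLen_strictMono d).monotone (show x₀ + 1 + 1 ≤ y₀ by omega)
    rw [iterate_imgLen_succ, iterate_imgLen_succ] at h8
    have := extLen_lt_iterLen_add d x₀
    omega
  subst hy
  rw [iterate_imgLen_succ] at h7
  exact ⟨d, x₀, o, ⟨h4, h5⟩, by omega, by omega, h2⟩

theorem Isolated.leftMax {x : ℕ} (hx : Isolated x) (d : ℕ) :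
    LeftMax (imgLen^[d] x) (imgLen^[d] x + iterLen d (letter x)) := by
  rw [← iterate_imgLen_succ]
  exact (leftMax_iterate_iff d (Nat.lt_succ_self x)).2 hx.2

theorem Isolated.agree {x : ℕ} (hx : Isolated x) {d n : ℕ} (hn : n ≤ extLen d) :
    Agree (imgLen^[d] x) (imgLen^[d] x + iterLen d (letter x)) n := by
  rw [← iterate_imgLen_succ]
  exact (agree_iterate_iff d hx.1).2 hn

theorem Isolated.agree_square {x d o : ℕ} (hx : Isolated x)
    (ho : o + iterLen d (letter x) ≤ extLen d) :
    Agree (imgLen^[d] x + o) (imgLen^[d] x + o + iterLen d (letter x))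
      (iterLen d (letter x)) := by
  intro j hj
  have := hx.agree ho (o + j) (by omega)
  rwa [← add_assoc, add_right_comm _ _ (o + j), ← add_assoc, add_right_comm _ j] at this

theorem Isolated.level_le {x x' d d' : ℕ} (hx : Isolated x) (h : imgLen^[d] x = imgLen^[d'] x')
    (h' : imgLen^[d] (x + 1) = imgLen^[d'] (x' + 1)) : d' ≤ d := by
  by_contra hlt
  obtain ⟨e, rfl⟩ : ∃ e, d' = d + (e + 1) := ⟨d' - d - 1, by omega⟩
  rw [Function.iterate_add_apply, Function.iterate_succ_apply'] at h h'
  apply hx.1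
  rw [(iterate_imgLen_strictMono d).injective h', letter_imgLen,
    (iterate_imgLen_strictMono d).injective h, letter_imgLen]

theorem Isolated.unique {x x' d d' o o' : ℕ} (hx : Isolated x) (hx' : Isolated x')
    (ho : o + iterLen d (letter x) ≤ extLen d) (ho' : o' + iterLen d' (letter x') ≤ extLen d')
    (h : imgLen^[d] x + o = imgLen^[d'] x' + o')
    (hp : iterLen d (letter x) = iterLen d' (letter x')) : d = d' ∧ x = x' ∧ o = o' := by
  have h1 : imgLen^[d] x = imgLen^[d'] x' := by
    have a1 := hx.agree ho
    have a2 := hx'.agree ho'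
    have l1 := hx.leftMax d
    have l2 := hx'.leftMax d'
    rw [hp] at a1 l1
    exact le_antisymm (l1.le_of_agree h.symm a2) (l2.le_of_agree h a1)
  have h2 : imgLen^[d] (x + 1) = imgLen^[d'] (x' + 1) := by
    rw [iterate_imgLen_succ, iterate_imgLen_succ, h1, hp]
  obtain rfl : d = d' := le_antisymm (hx'.level_le h1.symm h2.symm) (hx.level_le h1 h2)
  exact ⟨rfl, (iterate_imgLen_strictMono d).injective h1, by omega⟩

/-! ### Counting the occurrences of squares -/

theorem factor_eq_factor_iff {x y n : ℕ} : factor x n = factor y n ↔ Agree x y n := by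
  simp [factor, Agree]

theorem drop_factor_zero {i n : ℕ} (h : i ≤ n) : (factor 0 n).drop i = factor i (n - i) := by
  obtain ⟨k, rfl⟩ := Nat.exists_eq_add_of_le h
  rw [factor_add, List.drop_left' (length_factor _ _)]
  simp

theorem append_self_prefix_iff {w : List TLetter} {i n : ℕ} (h : i + 2 * w.length ≤ n) :
    w ++ w <+: (TPrefix n).drop i ↔
      w = factor i w.length ∧ Agree i (i + w.length) w.length := by
  obtain ⟨k, rfl⟩ := Nat.exists_eq_add_of_le h
  rw [TPrefix_eq_factor, drop_factor_zero (by omega),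
    show i + 2 * w.length + k - i = w.length + w.length + k by omega, factor_add, factor_add,
    ← factor_eq_factor_iff]
  constructor
  · intro hw
    have h1 := List.prefix_of_prefix_length_le hw (List.prefix_append _ _) (by simp)
    have h2 := List.append_inj (h1.eq_of_length (by simp)) (by simp)
    exact ⟨h2.1, h2.1.symm.trans h2.2⟩
  · rintro ⟨h1, h2⟩
    rw [← h2, ← h1]
    exact List.prefix_append _ _

open Classical in
/-- The parameters `(d, x, o)` of the squares occurring in the prefix of length `t_m`. -/
noncomputable def squareIndex (m : ℕ) : Finset (Σ _ : ℕ, Σ _ : ℕ, ℕ) :=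
  (Finset.range m).sigma fun d =>
    ((Finset.range (tribAux (m - d + 2))).filter Isolated).sigma fun x =>
      Finset.range (min (extLen d) (tribAux (m + 2) - imgLen^[d] (x + 1)) + 1 -
        iterLen d (letter x))

theorem mem_squareIndex {m d x o : ℕ} :
    (⟨d, x, o⟩ : Σ _ : ℕ, Σ _ : ℕ, ℕ) ∈ squareIndex m ↔
      Isolated x ∧ o + iterLen d (letter x) ≤ extLen d ∧
        imgLen^[d] x + o + 2 * iterLen d (letter x) ≤ tribAux (m + 2) := by
  have hpos := iterLen_pos d (letter x)
  have hs := iterate_imgLen_succ d x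
  simp only [squareIndex, Finset.mem_sigma, Finset.mem_range, Finset.mem_filter]
  constructor
  · rintro ⟨hd, ⟨hx, hi⟩, ho⟩
    have := (iterate_imgLen_strictMono d).monotone (Nat.succ_le_of_lt hx)
    rw [iterate_imgLen_tribAux, Nat.sub_add_cancel hd.le, Nat.succ_eq_add_one] at this
    exact ⟨hi, by omega, by omega⟩
  · rintro ⟨hi, ho, hn⟩
    have hlt : imgLen^[d] (x + 1) < tribAux (m + 2) := by omega
    have hd : d < m := by
      by_contra hmd
      have h1 := (iterate_imgLen_strictMono d).monotone (show 1 ≤ x + 1 by omega)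
      have h2 := iterate_imgLen_tribAux m 0
      have h3 : imgLen^[m] 1 ≤ imgLen^[d] 1 :=
        Function.monotone_iterate_of_id_le (fun z => imgLen_strictMono.le_apply)
          (not_lt.1 hmd) 1
      rw [show tribAux (0 + 2) = 1 from rfl, zero_add] at h2
      omega
    have hx : x + 1 < tribAux (m - d + 2) := by
      rw [← (iterate_imgLen_strictMono d).lt_iff_lt, iterate_imgLen_tribAux,
        Nat.sub_add_cancel hd.le]
      exact hlt
    exact ⟨hd, ⟨by omega, hi⟩, by omega⟩

theorem B_eq_card (m : ℕ) : B (tribAux (m + 2)) = (squareIndex m).card := by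
  let g : (Σ _ : ℕ, Σ _ : ℕ, ℕ) → List TLetter × ℕ := fun q =>
    (factor (imgLen^[q.1] q.2.1 + q.2.2) (iterLen q.1 (letter q.2.1)),
      imgLen^[q.1] q.2.1 + q.2.2 + 1)
  have hg : Set.InjOn g (squareIndex m : Set (Σ _ : ℕ, Σ _ : ℕ, ℕ)) := by
    rintro ⟨d, x, o⟩ h ⟨d', x', o'⟩ h' he
    obtain ⟨h1, h2, -⟩ := mem_squareIndex.1 h
    obtain ⟨h1', h2', -⟩ := mem_squareIndex.1 h'
    have e1 := congrArg (fun q => q.1.length) he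
    have e2 := congrArg Prod.snd he
    simp only [g, length_factor, Nat.add_right_cancel_iff] at e1 e2
    obtain ⟨rfl, rfl, rfl⟩ := h1.unique h1' h2 h2' e2 e1
    rfl
  have himg : {p : List TLetter × ℕ | p.1 ≠ [] ∧ 1 ≤ p.2 ∧
      p.2 + 2 * p.1.length - 1 ≤ tribAux (m + 2) ∧
      (p.1 ++ p.1) <+: (TPrefix (tribAux (m + 2))).drop (p.2 - 1)} = g '' squareIndex m := by
    ext ⟨w, i⟩
    simp only [Set.mem_ofPred_eq, Set.mem_image, Finset.mem_coe]
    constructor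
    · rintro ⟨hw, hi, hn, hp⟩
      obtain ⟨i, rfl⟩ : ∃ z, i = z + 1 := ⟨i - 1, by omega⟩
      rw [Nat.add_sub_cancel, append_self_prefix_iff (by omega)] at hp
      obtain ⟨d, x, o, h1, rfl, h3, h4⟩ :=
        exists_isolated_of_agree (List.length_pos_iff.2 hw) hp.2
      refine ⟨⟨d, x, o⟩, mem_squareIndex.2 ⟨h1, by omega, by omega⟩, ?_⟩
      simp only [g, ← h3, ← hp.1]
    · rintro ⟨⟨d, x, o⟩, h, he⟩
      obtain ⟨h1, h2, h3⟩ := mem_squareIndex.1 h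
      simp only [g, Prod.mk.injEq] at he
      obtain ⟨rfl, rfl⟩ := he
      have hpos := iterLen_pos d (letter x)
      refine ⟨?_, by omega, ?_, ?_⟩
      · rw [← List.length_pos_iff, length_factor]; exact hpos
      · rw [length_factor]; omega
      · rw [Nat.add_sub_cancel, append_self_prefix_iff (by rw [length_factor]; omega),
          length_factor]
        exact ⟨rfl, h1.agree_square h2⟩
  rw [B, ← Set.ncard_coe_finset, ← hg.ncard_image, ← himg]
  rfl

theorem isolated_of_letter_ne {x : ℕ} (h : letter x ≠ .a) : Isolated x := by
  refine ⟨by rwa [letter_succ_of_ne h], ?_⟩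
  cases x with
  | zero => exact .inl rfl
  | succ x => exact .inr (by simpa [letter_of_succ_ne h] using h.symm)

theorem isolated_imgLen_iff (j : ℕ) :
    Isolated (imgLen j) ↔ letter j ≠ .c ∧ (j = 0 ∨ letter (j - 1) ≠ .c) := by
  have h1 : letter (imgLen j) ≠ letter (imgLen j + 1) ↔ letter j ≠ .c := by
    rw [letter_imgLen]
    cases hj : letter j <;> simp [letter_imgLen_a, letter_imgLen_b, letter_imgLen_c, hj]
  have h2 : LeftMax (imgLen j) (imgLen j + 1) ↔ j = 0 ∨ letter (j - 1) ≠ .c := by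
    cases j with
    | zero => exact ⟨fun _ => .inl rfl, fun _ => .inl rfl⟩
    | succ j =>
      have hx : imgLen (j + 1) ≠ 0 := by have := lt_imgLen_succ j; omega
      simp only [LeftMax, hx, false_or, Nat.add_sub_cancel, letter_imgLen, Nat.succ_ne_zero]
      cases hj : letter j <;> simp [letter_imgLen_a, letter_imgLen_b, letter_imgLen,
        imgLen_succ_a, imgLen_succ_b, imgLen_succ_c, hj]
  rw [Isolated, h1, h2]

theorem count_factor_succ (l : TLetter) (n : ℕ) :
    (factor 0 (n + 1)).count l = (factor 0 n).count l + if letter n = l then 1 else 0 := by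
  rw [factor_add, List.count_append, zero_add, factor_one, List.count_singleton]
  simp

open Classical in
theorem sum_isolated (f : TLetter → ℚ) (M : ℕ) :
    ∑ x ∈ Finset.range (imgLen M), (if Isolated x then f (letter x) else 0) =
      (factor 0 M).count .a * (f .a + f .b) + (factor 0 M).count .b * (f .a + f .c) -
        (factor 0 (M - 1)).count .c * f .a := by
  induction M with
  | zero => simp [imgLen_zero, factor]
  | succ M ih =>
    have hc : ((factor 0 M).count .c : ℚ) =
        (factor 0 (M - 1)).count .c + if M = 0 ∨ letter (M - 1) ≠ .c then 0 else 1 := by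
      cases M with
      | zero => simp
      | succ M => rw [count_factor_succ]; by_cases h : letter M = .c <;> simp [h]
    have hM := isolated_imgLen_iff M
    have hcc : ¬ (M = 0 ∨ letter (M - 1) ≠ .c) → letter M = .a := by
      intro h
      push Not at h
      rw [← Nat.sub_add_cancel (Nat.pos_of_ne_zero h.1)]
      exact letter_succ_of_ne (by rw [h.2]; decide)
    rw [Nat.add_sub_cancel, count_factor_succ, count_factor_succ, hc]
    cases h : letter M
    · have h1 : Isolated (imgLen M + 1) :=
        isolated_of_letter_ne (by rw [letter_imgLen_a h]; decide)
      rw [imgLen_succ_a h, Finset.sum_range_succ, Finset.sum_range_succ, ih, letter_imgLen,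
        letter_imgLen_a h, if_pos h1]
      by_cases h2 : M = 0 ∨ letter (M - 1) ≠ .c
      · rw [if_pos (hM.2 ⟨by rw [h]; decide, h2⟩), if_pos h2]
        push_cast; simp; ring
      · rw [if_neg (fun h3 => h2 (hM.1 h3).2), if_neg h2]
        push_cast; simp; ring
    · have h1 : Isolated (imgLen M + 1) :=
        isolated_of_letter_ne (by rw [letter_imgLen_b h]; decide)
      have h2 : M = 0 ∨ letter (M - 1) ≠ .c := by
        by_contra h2
        rw [hcc h2] at h
        exact absurd h (by decide)
      rw [imgLen_succ_b h, Finset.sum_range_succ, Finset.sum_range_succ, ih, letter_imgLen,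
        letter_imgLen_b h, if_pos h1, if_pos (hM.2 ⟨by rw [h]; decide, h2⟩), if_pos h2]
      push_cast; simp; ring
    · have h2 : M = 0 ∨ letter (M - 1) ≠ .c := by
        by_contra h2
        rw [hcc h2] at h
        exact absurd h (by decide)
      rw [imgLen_succ_c h, Finset.sum_range_succ, ih, if_neg (fun h3 => (hM.1 h3).1 h), if_pos h2]
      simp

theorem count_imgLen (M : ℕ) :
    (factor 0 (imgLen M)).count .a = M ∧
      (factor 0 (imgLen M)).count .b = (factor 0 M).count .a ∧
        (factor 0 (imgLen M)).count .c = (factor 0 M).count .b := by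
  induction M with
  | zero => decide
  | succ M ih =>
    obtain ⟨h1, h2, h3⟩ := ih
    have := letter_imgLen M
    cases h : letter M
    · rw [imgLen_succ_a h]
      simp [count_factor_succ, letter_imgLen_a, *]
    · rw [imgLen_succ_b h]
      simp [count_factor_succ, letter_imgLen_b, *]
    · rw [imgLen_succ_c h]
      simp [count_factor_succ, *]

theorem count_tribAux : ∀ k, (factor 0 (tribAux (k + 2))).count .a = tribAux (k + 1) ∧
    (factor 0 (tribAux (k + 2))).count .b = tribAux k ∧
      (factor 0 (tribAux (k + 2))).count .c + tribAux (k + 1) + tribAux k = tribAux (k + 2)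
  | 0 => by decide
  | 1 => by decide
  | k + 2 => by
    obtain ⟨h1, h2, h3⟩ := count_tribAux (k + 1)
    obtain ⟨h4, h5, h6⟩ := count_imgLen (tribAux (k + 3))
    rw [show imgLen (tribAux (k + 3)) = tribAux (k + 2 + 2) from imgLen_tribAux (k + 1)] at h4 h5 h6
    refine ⟨h4, h5.trans h1, ?_⟩
    rw [h6, show (factor 0 (tribAux (k + 3))).count .b = tribAux (k + 1) from h2]
    have : tribAux (k + 2 + 2) = tribAux (k + 3) + tribAux (k + 2) + tribAux (k + 1) := rfl
    have : tribAux (k + 2 + 1) = tribAux (k + 3) := rfl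
    omega

/-- The last letter of the `k`-th finite Tribonacci word. -/
theorem last_letter (k : ℕ) : ∃ M, tribAux (k + 2) = M + 1 ∧
    (k % 3 = 0 ∧ letter M = .a ∧ (M = 0 ∨ letter (M - 1) = .b) ∨ k % 3 = 1 ∧ letter M = .b ∨
      k % 3 = 2 ∧ letter M = .c) := by
  induction k with
  | zero => exact ⟨0, rfl, .inl ⟨rfl, rfl, .inl rfl⟩⟩
  | succ k ih =>
    obtain ⟨M, hM, h⟩ := ih
    have hN := imgLen_tribAux k
    rw [hM] at hN
    rw [show k + 1 + 2 = k + 3 by rfl, ← hN]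
    rcases h with ⟨h, h1, -⟩ | ⟨h, h1⟩ | ⟨h, h1⟩
    · exact ⟨imgLen M + 1, imgLen_succ_a h1, .inr (.inl ⟨by omega, letter_imgLen_a h1⟩)⟩
    · exact ⟨imgLen M + 1, imgLen_succ_b h1, .inr (.inr ⟨by omega, letter_imgLen_b h1⟩)⟩
    · refine ⟨imgLen M, imgLen_succ_c h1, .inl ⟨by omega, letter_imgLen M, .inr ?_⟩⟩
      cases M with
      | zero => exact absurd h1 (by decide)
      | succ M =>
        have h2 : letter M = .a := letter_of_succ_ne (by rw [h1]; decide)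
        rw [imgLen_succ_a h2]
        exact letter_imgLen_a h2

theorem tribAux_add_succ_le : ∀ d, tribAux (d + 1) + tribAux d ≤ tribAux (d + 2)
  | 0 => by decide
  | d + 1 => Nat.le_add_right _ _

theorem tribAux_add_two_le (d : ℕ) : tribAux (d + 2) ≤ extLen d + 1 := by
  induction d with
  | zero => decide
  | succ d ih =>
    have h1 : tribAux (d + 1 + 2) = tribAux (d + 2) + tribAux (d + 1) + tribAux d := rfl
    have h2 : extLen (d + 1) = tribAux (d + 2) + extLen d := rfl
    have h3 := tribAux_add_succ_le d
    omega

theorem tribAux_le_extLen (d : ℕ) : tribAux (d + 5) ≤ extLen (d + 3) := by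
  have h1 := two_mul_extLen (d + 3)
  have h2 : tribAux (d + 3 + 3) = tribAux (d + 5) + tribAux (d + 4) + tribAux (d + 3) := rfl
  have h3 : tribAux (d + 3 + 1) = tribAux (d + 4) := rfl
  have h4 : tribAux (d + 5) = tribAux (d + 4) + tribAux (d + 3) + tribAux (d + 2) := rfl
  have h5 : tribAux (d + 4) = tribAux (d + 3) + tribAux (d + 2) + tribAux (d + 1) := rfl
  have h6 : tribAux (d + 3) = tribAux (d + 2) + tribAux (d + 1) + tribAux d := rfl
  have h7 := tribAux_succ_pos d
  have h8 := tribAux_succ_pos (d + 1)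
  have h9 : tribAux (d + 1 + 1) = tribAux (d + 2) := rfl
  omega

theorem iterLen_le (d : ℕ) (l : TLetter) : iterLen d l ≤ extLen d + 1 := by
  refine le_trans ?_ (tribAux_add_two_le d)
  have := tribAux_add_succ_le d
  cases l <;> simp only [iterLen] <;> omega

/-- The number of squares at the level `d` generated by an isolated letter `l`. -/
def squareCount (d : ℕ) (l : TLetter) : ℚ := extLen d + 1 - iterLen d l

open Classical in
/-- The number of squares at the level `d` inside the prefix of length `t_{k+d}`. -/
noncomputable def levelCount (d k : ℕ) : ℕ :=
  ∑ x ∈ (Finset.range (tribAux (k + 2))).filter Isolated,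
    (min (extLen d) (tribAux (k + d + 2) - imgLen^[d] (x + 1)) + 1 - iterLen d (letter x))

theorem card_squareIndex (m : ℕ) :
    (squareIndex m).card = ∑ d ∈ Finset.range m, levelCount d (m - d) := by
  rw [squareIndex, Finset.card_sigma]
  refine Finset.sum_congr rfl fun d hd => ?_
  rw [levelCount, Finset.card_sigma, Nat.sub_add_cancel (Finset.mem_range.1 hd).le]
  simp only [Finset.card_range]

open Classical in
theorem levelCount_eq {d k N : ℕ} (hN : tribAux (k + 2) = N + 2) (hi : Isolated N) :
    (levelCount d k : ℚ) =
      ∑ x ∈ Finset.range (tribAux (k + 2)),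
          (if Isolated x then squareCount d (letter x) else 0) -
        squareCount d (letter N) -
        (if Isolated (N + 1) then squareCount d (letter (N + 1)) else 0) +
        (min (extLen d) (iterLen d (letter (N + 1))) + 1 - iterLen d (letter N) : ℕ) := by
  have hn := iterate_imgLen_tribAux d k
  rw [hN] at hn
  rw [levelCount, ← hn, hN, Finset.sum_filter, Nat.cast_sum, Finset.sum_range_succ,
    Finset.sum_range_succ, Finset.sum_range_succ, Finset.sum_range_succ, if_pos hi, if_pos hi]
  have hlast : min (extLen d) (imgLen^[d] (N + 2) - imgLen^[d] (N + 1 + 1)) + 1 -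
      iterLen d (letter (N + 1)) = 0 := by
    have := iterLen_pos d (letter (N + 1))
    rw [Nat.sub_self]
    omega
  have hpen : imgLen^[d] (N + 2) - imgLen^[d] (N + 1) = iterLen d (letter (N + 1)) := by
    rw [iterate_imgLen_succ d (N + 1)]
    omega
  have hrest : ∑ x ∈ Finset.range N, (((if Isolated x then
      min (extLen d) (imgLen^[d] (N + 2) - imgLen^[d] (x + 1)) + 1 - iterLen d (letter x)
      else 0 : ℕ)) : ℚ) =
      ∑ x ∈ Finset.range N, (if Isolated x then squareCount d (letter x) else 0) := by
    refine Finset.sum_congr rfl fun x hx => ?_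
    split_ifs
    · have h1 := (iterate_imgLen_strictMono d).monotone
        (show x + 1 + 1 + 1 ≤ N + 2 by have := Finset.mem_range.1 hx; omega)
      rw [iterate_imgLen_succ d (x + 1 + 1), iterate_imgLen_succ d (x + 1)] at h1
      have h2 := extLen_lt_iterLen_add d (x + 1)
      rw [min_eq_left (by omega), Nat.cast_sub (iterLen_le _ _), squareCount]
      push_cast
      ring
    · simp
  rw [hlast, hpen, hrest]
  push_cast
  simp only [ite_self]
  ring

theorem levelCount_tail_ab (d : ℕ) : min (extLen d) (iterLen d .b) + 1 - iterLen d .a = 0 := by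
  match d with
  | 0 => rfl
  | 1 => rfl
  | d + 2 =>
    have h1 : tribAux (d + 2 + 2) = tribAux (d + 2 + 1) + tribAux (d + 2) + tribAux (d + 1) := rfl
    have h2 := tribAux_succ_pos d
    simp only [iterLen]
    omega

theorem levelCount_tail_ac (d : ℕ) : min (extLen d) (iterLen d .c) + 1 - iterLen d .a = 0 := by
  match d with
  | 0 => rfl
  | d + 1 =>
    have h1 : tribAux (d + 1 + 2) = tribAux (d + 1 + 1) + tribAux (d + 1) + tribAux d := rfl
    have h2 := tribAux_succ_pos d
    simp only [iterLen]
    omega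

theorem levelCount_tail_ba (d : ℕ) :
    ((min (extLen d) (iterLen d .a) + 1 - iterLen d .b : ℕ) : ℚ) =
      iterLen d .a + 1 - iterLen d .b - if d ≤ 2 then 1 else 0 := by
  match d with
  | 0 => norm_num [extLen, iterLen, tribAux]
  | 1 => norm_num [extLen, iterLen, tribAux]
  | 2 => norm_num [extLen, iterLen, tribAux]
  | d + 3 =>
    have h1 : iterLen (d + 3) .a ≤ extLen (d + 3) := tribAux_le_extLen d
    have h2 : iterLen (d + 3) .b ≤ iterLen (d + 3) .a := tribAux_add_succ_le (d + 3)
    rw [min_eq_right h1, Nat.cast_sub (by omega), if_neg (by omega)]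
    push_cast
    ring

/-- The correction to the count at the level `d` coming from the end of the prefix. -/
def tailCorrection (d k : ℕ) : ℚ :=
  if k % 3 = 0 then -squareCount d .a - squareCount d .b
  else if k % 3 = 1 then -squareCount d .a - squareCount d .c else 1

theorem levelCount_succ (d k : ℕ) :
    (levelCount d (k + 1) : ℚ) =
      tribAux (k + 1) * (squareCount d .a + squareCount d .b) +
        tribAux k * (squareCount d .a + squareCount d .c) -
        (tribAux (k + 2) - tribAux (k + 1) - tribAux k) * squareCount d .a +
        tailCorrection d k - if d ≤ 2 ∧ k % 3 = 2 then 1 else 0 := by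
  classical
  obtain ⟨M, hM, h⟩ := last_letter k
  obtain ⟨ha, hb, hc⟩ := count_tribAux k
  have hsum := sum_isolated (squareCount d) (tribAux (k + 2))
  have hN : tribAux (k + 1 + 2) = imgLen (M + 1) := by rw [← hM]; exact (imgLen_tribAux k).symm
  have hN' : tribAux (k + 1 + 2) = imgLen (tribAux (k + 2)) := (imgLen_tribAux k).symm
  have hcQ : ((factor 0 (M + 1)).count .c : ℚ) =
      tribAux (k + 2) - tribAux (k + 1) - tribAux k := by
    have : ((factor 0 (tribAux (k + 2))).count .c + tribAux (k + 1) + tribAux k : ℚ) =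
        tribAux (k + 2) := by exact_mod_cast hc
    rw [← hM]
    linarith
  rw [count_factor_succ] at hcQ
  rw [ha, hb, ← hN', show tribAux (k + 2) - 1 = M by omega] at hsum
  rcases h with ⟨hk, h1, h2⟩ | ⟨hk, h1⟩ | ⟨hk, h1⟩
  · have ht : tailCorrection d k = -squareCount d .a - squareCount d .b := by
      simp [tailCorrection, hk]
    have hi : Isolated (imgLen M) := (isolated_imgLen_iff M).2 ⟨by rw [h1]; decide,
      h2.imp_right fun h => by rw [h]; decide⟩
    have hi' : Isolated (imgLen M + 1) :=
      isolated_of_letter_ne (by rw [letter_imgLen_a h1]; decide)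
    rw [levelCount_eq (hN.trans (imgLen_succ_a h1)) hi, hsum, if_pos hi', letter_imgLen,
      letter_imgLen_a h1, levelCount_tail_ab, ← hcQ, h1, ht,
      if_neg (show ¬ (d ≤ 2 ∧ k % 3 = 2) by omega)]
    simp
    ring
  · have ht : tailCorrection d k = -squareCount d .a - squareCount d .c := by
      simp [tailCorrection, hk]
    have hM0 : M ≠ 0 := by rintro rfl; exact absurd h1 (by decide)
    have h3 : letter (M - 1) = .a :=
      letter_of_succ_ne (by rw [Nat.sub_add_cancel (Nat.pos_of_ne_zero hM0), h1]; decide)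
    have hi : Isolated (imgLen M) := (isolated_imgLen_iff M).2 ⟨by rw [h1]; decide,
      .inr (by rw [h3]; decide)⟩
    have hi' : Isolated (imgLen M + 1) :=
      isolated_of_letter_ne (by rw [letter_imgLen_b h1]; decide)
    rw [levelCount_eq (hN.trans (imgLen_succ_b h1)) hi, hsum, if_pos hi', letter_imgLen,
      letter_imgLen_b h1, levelCount_tail_ac, ← hcQ, h1, ht,
      if_neg (show ¬ (d ≤ 2 ∧ k % 3 = 2) by omega)]
    simp
    ring
  · have ht : tailCorrection d k = 1 := by simp [tailCorrection, hk]
    obtain ⟨M, rfl⟩ : ∃ z, M = z + 1 := by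
      cases M with
      | zero => exact absurd h1 (by decide)
      | succ M => exact ⟨M, rfl⟩
    have h3 : letter M = .a := letter_of_succ_ne (by rw [h1]; decide)
    have hi : Isolated (imgLen M + 1) :=
      isolated_of_letter_ne (by rw [letter_imgLen_a h3]; decide)
    have hi' : ¬ Isolated (imgLen M + 1 + 1) := fun h => ((isolated_imgLen_iff (M + 1)).1
      (by rwa [imgLen_succ_a h3])).1 h1
    have h4 : letter (imgLen M + 1 + 1) = .a := by
      have := letter_imgLen (M + 1)
      rwa [imgLen_succ_a h3] at this
    rw [levelCount_eq (N := imgLen M + 1)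
        (hN.trans (by rw [imgLen_succ_c h1, imgLen_succ_a h3])) hi,
      hsum, if_neg hi', h4, letter_imgLen_a h3, levelCount_tail_ba, ← hcQ, h1, ht]
    simp only [hk, and_true, squareCount]
    simp
    ring

/-- The part of a discrete primitive of `levelCount` that depends on `k` modulo `3`. -/
def periodicPrimitive (d k : ℕ) : ℚ :=
  if k % 3 = 2 then (tribAux d - tribAux (d + 2)) / 2 else -(tribAux d + tribAux (d + 2)) / 2

/-- A discrete primitive of the main part of `levelCount` along the lines of constant `d + k`. -/
def primitive (d k : ℕ) : ℚ :=
  -1 / 4 * tribAux k - 1 / 2 * tribAux (k + 1) + 5 / 4 * tribAux (k + 2) +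
    tribAux (d + 1) *
      (-41 / 22 * tribAux k + 8 / 11 * tribAux (k + 1) - 1 / 22 * tribAux (k + 2)) +
    tribAux (d + 2) *
      (29 / 22 * tribAux k - 3 / 22 * tribAux (k + 1) - 3 / 11 * tribAux (k + 2)) +
    d * (1 +
      tribAux d * (5 / 11 * tribAux k - 9 / 22 * tribAux (k + 1) + 2 / 11 * tribAux (k + 2)) +
      tribAux (d + 1) *
        (-9 / 22 * tribAux k - 15 / 22 * tribAux (k + 1) + 7 / 11 * tribAux (k + 2)) +
      tribAux (d + 2) *
        (2 / 11 * tribAux k + 7 / 11 * tribAux (k + 1) - 5 / 22 * tribAux (k + 2))) +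
    periodicPrimitive d k

theorem levelCount_succ_eq_sub (d k : ℕ) :
    (levelCount d (k + 1) : ℚ) = primitive (d + 1) k - primitive d (k + 1) -
      if d ≤ 2 ∧ k % 3 = 2 then 1 else 0 := by
  have hS : (extLen d : ℚ) = (tribAux (d + 3) + tribAux (d + 1) - 3) / 2 := by
    have : (2 * extLen d + 3 : ℚ) = tribAux (d + 3) + tribAux (d + 1) := by
      exact_mod_cast two_mul_extLen d
    linarith
  have hd : (tribAux (d + 3) : ℚ) = tribAux (d + 2) + tribAux (d + 1) + tribAux d := by
    exact_mod_cast tribAux_add_three d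
  have hk : (tribAux (k + 3) : ℚ) = tribAux (k + 2) + tribAux (k + 1) + tribAux k := by
    exact_mod_cast tribAux_add_three k
  rw [levelCount_succ]
  congr 1
  simp only [primitive, periodicPrimitive, tailCorrection, squareCount, iterLen, hS,
    show d + 1 + 1 = d + 2 from rfl, show d + 1 + 2 = d + 3 from rfl,
    show k + 1 + 1 = k + 2 from rfl, show k + 1 + 2 = k + 3 from rfl, hd, hk]
  push_cast
  have h3 := Nat.mod_lt k (show 3 > 0 by decide)
  rcases (by omega : k % 3 = 0 ∨ k % 3 = 1 ∨ k % 3 = 2) with h | h | h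
  · simp only [h, show (k + 1) % 3 = 1 by omega]
    norm_num
    ring
  · simp only [h, show (k + 1) % 3 = 2 by omega]
    norm_num
    ring
  · simp only [h, show (k + 1) % 3 = 0 by omega]
    norm_num
    ring

theorem B_tribAux {m : ℕ} (hm : 3 ≤ m) :
    (B (tribAux (m + 2)) : ℚ) = primitive m 0 - primitive 0 m - 1 := by
  rw [B_eq_card, card_squareIndex, Nat.cast_sum]
  have h1 : ∀ d ∈ Finset.range m, (levelCount d (m - d) : ℚ) =
      (primitive (d + 1) (m - (d + 1)) - primitive d (m - d)) -
        if d = m % 3 then 1 else 0 := by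
    intro d hd
    have hd := Finset.mem_range.1 hd
    obtain ⟨k, hk⟩ : ∃ k, m - d = k + 1 := ⟨m - d - 1, by omega⟩
    rw [show m - (d + 1) = k by omega, hk, levelCount_succ_eq_sub]
    congr 2
    exact propext ⟨by omega, by omega⟩
  rw [Finset.sum_congr rfl h1, Finset.sum_sub_distrib,
    Finset.sum_range_sub (fun d => primitive d (m - d)), Finset.sum_ite_eq',
    if_pos (Finset.mem_range.2 (by omega)), Nat.sub_self, Nat.sub_zero]

end Tribonacci

theorem repeated_squares_at_tribonacci (m : ℤ) (hm : 3 ≤ m) :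
    (B (t m) : ℚ) =
      (m : ℚ) / 22 * (9 * (t m : ℚ) - (t (m - 1) : ℚ) - 5 * (t (m - 2) : ℚ)) +
      1 / 44 * (-81 * (t m : ℚ) + 26 * (t (m - 1) : ℚ) + 13 * (t (m - 2) : ℚ)) +
      (m : ℚ) + 1 / 4 := by
  lift m to ℕ using by omega
  rw [show t m = tribAux (m + 2) from rfl,
    show t ((m : ℤ) - 1) = tribAux (m + 1) by rw [t]; congr 1; omega,
    show t ((m : ℤ) - 2) = tribAux m by rw [t]; congr 1; omega,
    Tribonacci.B_tribAux (by omega)]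
  simp only [Tribonacci.primitive, Tribonacci.periodicPrimitive, tribAux]
  split_ifs <;> first | contradiction | (push_cast; ring)
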